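/- arXiv:1705.08878 — 5 statements merged into one kernel-verified Lean document; each statement's English description precedes it below -/
import Mathlib

section
/- Let g(x) := (x+1)·log₂(x+1) − x·log₂(x) for x > 0 and g(0) := 0, where log₂ denotes the base-2 logarithm. Fix κ > 1 and n_th > 0. Then, as n̄ tends to 0 from the right, the quantity (g(κ·n_th + (κ−1)·(n̄+1)) − g(κ·(n_th+1) − 1)) / n̄ converges to (κ−1)·log₂(1 + 1/(κ·(n_th+1) − 1)). -/
/-- `g x = (x+1) log₂ (x+1) - x log₂ x`, with `g 0 = 0` (automatic from
Mathlib's convention `Real.log 0 = 0`). -/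
noncomputable def g (x : ℝ) : ℝ :=
  (x + 1) * Real.logb 2 (x + 1) - x * Real.logb 2 x

/-- The derivative of `g` at a positive point. -/
theorem hasDerivAt_g {x : ℝ} (hx : 0 < x) :
    HasDerivAt g (Real.logb 2 (1 + 1 / x)) x := by
  have hx1 : 0 < x + 1 := by linarith
  have h₁ := (Real.hasDerivAt_mul_log hx1.ne').comp_add_const x 1
  have h₂ := Real.hasDerivAt_mul_log hx.ne'
  have h := (h₁.sub h₂).div_const (Real.log 2)
  have hg : g = fun y : ℝ =>
      ((y + 1) * Real.log (y + 1) - y * Real.log y) / Real.log 2 := by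
    funext y
    simp only [g, Real.logb]
    ring
  have hd : Real.logb 2 (1 + 1 / x) =
      (Real.log (x + 1) + 1 - (Real.log x + 1)) / Real.log 2 := by
    rw [show 1 + 1 / x = (x + 1) / x by field_simp, Real.logb,
      Real.log_div hx1.ne' hx.ne']
    ring
  rw [hg, hd]
  exact h

/-- Classical capacity per unit cost of the contravariant amplifier channel:
`(g (κ n_th + (κ-1)(n̄+1)) - g (κ(n_th+1) - 1)) / n̄ →
  (κ-1) log₂ (1 + 1/(κ(n_th+1) - 1))` as `n̄ → 0⁺`. -/
theorem contravariant_amplifier_capacity_per_unit_cost (κ nth : ℝ)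
    (hκ : 1 < κ) (hnth : 0 < nth) :
    Filter.Tendsto
      (fun n : ℝ =>
        (g (κ * nth + (κ - 1) * (n + 1)) - g (κ * (nth + 1) - 1)) / n)
      (nhdsWithin 0 (Set.Ioi 0))
      (nhds ((κ - 1) * Real.logb 2 (1 + 1 / (κ * (nth + 1) - 1)))) := by
  have hpos : 0 < κ * (nth + 1) - 1 := by nlinarith
  have hline : HasDerivAt (fun n : ℝ => κ * nth + (κ - 1) * (n + 1)) (κ - 1) 0 := by
    simpa using (((hasDerivAt_id (0 : ℝ)).add_const 1).const_mul (κ - 1)).const_add (κ * nth)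
  have hzero : κ * nth + (κ - 1) * ((0 : ℝ) + 1) = κ * (nth + 1) - 1 := by ring
  have hcomp := HasDerivAt.comp (0 : ℝ) (hzero ▸ hasDerivAt_g hpos) hline
  have hslope := hcomp.tendsto_slope_zero_right
  rw [hzero, mul_comm _ (κ - 1)] at hslope
  refine hslope.congr fun n => ?_
  simp only [Function.comp_apply, zero_add, smul_eq_mul]
  rw [show κ * nth + (κ - 1) * 1 = κ * (nth + 1) - 1 by ring]
  ring
end

section
/- Let g(x) := (x+1)·log₂(x+1) − x·log₂(x) for x > 0 and g(0) := 0, where log₂ denotes the base-2 logarithm, and write e for Euler's number. Fix η ∈ (0, 1). Then, as n̄ tends to 0 from the right, the quantity (g(η·n̄) − g((1−η)·n̄))/n̄ − (2η−1)·log₂(1/n̄) converges to (2η−1)·log₂(e) − η·log₂(η) + (1−η)·log₂(1−η). -/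
/-- The slope at `0` of `x ↦ (a x + 1) log₂ (a x + 1)` is `a log₂ e`. -/
theorem tendsto_mul_logb_add_one_div (a : ℝ) :
    Filter.Tendsto (fun x : ℝ => (a * x + 1) * Real.logb 2 (a * x + 1) / x)
      (nhdsWithin 0 (Set.Ioi 0)) (nhds (a * Real.logb 2 (Real.exp 1))) := by
  have hlin : HasDerivAt (fun x : ℝ => a * x + 1) a 0 := by
    simpa using ((hasDerivAt_id (0 : ℝ)).const_mul a).add_const 1
  have hderiv := hlin.mul ((hlin.log (by simp)).div_const (Real.log 2))
  have hslope := hderiv.tendsto_slope_zero_right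
  simp only [Pi.mul_apply, zero_add, mul_zero, Real.log_one, zero_div, sub_zero, smul_eq_mul,
    div_one, one_mul] at hslope
  convert hslope using 2
  · simp only [Real.logb]
    ring
  · simp [Real.logb, div_eq_mul_inv]

/-- The ratio `g (a x) / x` is asymptotic to `a log₂ (1/x)`, with constant term
`a log₂ e - a log₂ a`. -/
theorem tendsto_g_mul_div_sub {a : ℝ} (ha : 0 < a) :
    Filter.Tendsto (fun x : ℝ => g (a * x) / x - a * Real.logb 2 (1 / x))
      (nhdsWithin 0 (Set.Ioi 0))
      (nhds (a * Real.logb 2 (Real.exp 1) - a * Real.logb 2 a)) := by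
  refine ((tendsto_mul_logb_add_one_div a).sub_const (a * Real.logb 2 a)).congr' ?_
  filter_upwards [self_mem_nhdsWithin] with x hx
  have hx0 : x ≠ 0 := ne_of_gt hx
  rw [g, one_div, Real.logb_inv, Real.logb_mul ha.ne' hx0]
  field_simp
  ring

/-- The divergent part of the private/quantum capacity per unit cost ratio of
the pure-loss channel is `(2η-1) log₂ (1/n̄)`: as `n̄ → 0⁺`,
`(g (η n̄) - g ((1-η) n̄))/n̄ - (2η-1) log₂ (1/n̄)` converges to
`(2η-1) log₂ e - η log₂ η + (1-η) log₂ (1-η)`. -/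
theorem pure_loss_ratio_divergent_term (η : ℝ) (hη : η ∈ Set.Ioo (0 : ℝ) 1) :
    Filter.Tendsto
      (fun n : ℝ =>
        (g (η * n) - g ((1 - η) * n)) / n
          - (2 * η - 1) * Real.logb 2 (1 / n))
      (nhdsWithin 0 (Set.Ioi 0))
      (nhds ((2 * η - 1) * Real.logb 2 (Real.exp 1)
        - η * Real.logb 2 η + (1 - η) * Real.logb 2 (1 - η))) := by
  convert (tendsto_g_mul_div_sub hη.1).sub
    (tendsto_g_mul_div_sub (sub_pos.mpr hη.2)) using 2 <;> ring
end

section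
/- Let g(x) := (x+1)·log₂(x+1) − x·log₂(x) for x > 0 and g(0) := 0, where log₂ denotes the base-2 logarithm. Fix η ∈ (0, 1) and n_th > 0, and for n̄ > 0 set D(n̄) := √(((1+η)·n̄ + (1−η)·n_th + 1)² − 4·η·n̄·(n̄+1)) and F(n̄) := g(n̄) + g(η·n̄ + (1−η)·n_th) − g((D(n̄) − (1−η)·(n̄ − n_th) − 1)/2) − g((D(n̄) + (1−η)·(n̄ − n_th) − 1)/2). Then F(n̄)/n̄ tends to +∞ as n̄ tends to 0 from the right. -/
/-- The discriminant term in the entanglement-assisted capacity cost function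
of the thermal channel. -/
noncomputable def D (η nth n : ℝ) : ℝ :=
  Real.sqrt (((1 + η) * n + (1 - η) * nth + 1) ^ 2 - 4 * η * n * (n + 1))

/-- The entanglement-assisted capacity cost function of the thermal channel. -/
noncomputable def F (η nth n : ℝ) : ℝ :=
  g n + g (η * n + (1 - η) * nth)
    - g ((D η nth n - (1 - η) * (n - nth) - 1) / 2)
    - g ((D η nth n + (1 - η) * (n - nth) - 1) / 2)

open Filter Topology in
/-- The right difference quotient at `0` of a function vanishing at `0` tends to the derivative. -/
lemma HasDerivAt.tendsto_div_nhdsGT_zero {f : ℝ → ℝ} {f' : ℝ} (hf : HasDerivAt f f' 0)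
    (h0 : f 0 = 0) : Tendsto (fun t => f t / t) (𝓝[>] 0) (𝓝 f') := by
  refine (hf.tendsto_slope_zero.mono_left (nhdsGT_le_nhdsNE 0)).congr fun t => ?_
  simp [h0, div_eq_inv_mul]

lemma D_zero {η nth : ℝ} (h : 0 ≤ (1 - η) * nth) : D η nth 0 = (1 - η) * nth + 1 := by
  have : ((1 + η) * 0 + (1 - η) * nth + 1) ^ 2 - 4 * η * 0 * (0 + 1)
      = ((1 - η) * nth + 1) ^ 2 := by ring
  rw [D, this, Real.sqrt_sq (by linarith)]

lemma hasDerivAt_D_zero {η nth : ℝ} (h : 0 ≤ (1 - η) * nth) :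
    HasDerivAt (D η nth) (1 + η - 2 * η / ((1 - η) * nth + 1)) 0 := by
  have hD := D_zero h
  have hne : (1 - η) * nth + 1 ≠ 0 := by linarith
  have hrad : HasDerivAt
      (fun n : ℝ => ((1 + η) * n + (1 - η) * nth + 1) ^ 2 - 4 * η * n * (n + 1))
      (2 * (1 + η) * ((1 - η) * nth + 1) - 4 * η) 0 := by
    have hid := hasDerivAt_id (0 : ℝ)
    refine HasDerivAt.congr_deriv (((((hid.const_mul (1 + η)).add_const
      ((1 - η) * nth)).add_const 1).pow 2).sub
      ((hid.const_mul (4 * η)).mul (hid.add_const 1))) ?_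
    simp
    ring
  have hpos : ((1 + η) * 0 + (1 - η) * nth + 1) ^ 2 - 4 * η * 0 * (0 + 1) ≠ 0 := by
    simpa using hne
  have := hrad.sqrt hpos
  change HasDerivAt (D η nth) (_ / (2 * D η nth 0)) 0 at this
  rw [hD] at this
  convert this using 1
  field_simp
  ring

lemma differentiableAt_add_one_mul_logb {x : ℝ} (hx : x + 1 ≠ 0) :
    DifferentiableAt ℝ (fun x : ℝ => (x + 1) * Real.logb 2 (x + 1)) x := by
  unfold Real.logb
  fun_prop (disch := assumption)

lemma differentiableAt_g {x : ℝ} (hx : 0 < x) : DifferentiableAt ℝ g x := by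
  have h0 : x ≠ 0 := hx.ne'
  have h1 : x + 1 ≠ 0 := by linarith
  unfold g Real.logb
  fun_prop (disch := assumption)

open Filter Topology in
/-- If `u n ~ a n` as `n → 0⁺` with `0 < a < 1`, then `u n log₂ (u n) - n log₂ n` dominates `n`. -/
lemma tendsto_mul_logb_sub_mul_logb_div_atTop {u : ℝ → ℝ} {a : ℝ} (ha0 : 0 < a) (ha1 : a < 1)
    (hu : Tendsto (fun n => u n / n) (𝓝[>] 0) (𝓝 a)) :
    Tendsto (fun n => (u n * Real.logb 2 (u n) - n * Real.logb 2 n) / n) (𝓝[>] 0) atTop := by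
  have hlog : Tendsto (fun n : ℝ => -Real.logb 2 n) (𝓝[>] 0) atTop :=
    tendsto_neg_atBot_atTop.comp
      (Real.tendsto_log_nhdsGT_zero.atBot_div_const (Real.log_pos one_lt_two))
  have hmain := ((tendsto_const_nhds (x := (1 : ℝ))).sub hu).pos_mul_atTop (sub_pos.2 ha1) hlog
  have hrest : Tendsto (fun n => u n / n * Real.logb 2 (u n / n)) (𝓝[>] 0)
      (𝓝 (a * Real.logb 2 a)) :=
    hu.mul ((hu.log ha0.ne').div_const _)
  refine (hmain.atTop_add hrest).congr' ?_
  filter_upwards [self_mem_nhdsWithin, hu.eventually (lt_mem_nhds ha0)] with n hn hun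
  have hn0 : n ≠ 0 := (Set.mem_Ioi.1 hn).ne'
  have hu0 : u n ≠ 0 := by
    rintro h
    simp [h] at hun
  rw [Real.logb_div hu0 hn0]
  field_simp
  ring

/-- The entanglement-assisted classical capacity per unit cost of the thermal
channel is infinite: `F n̄ / n̄ → +∞` as `n̄ → 0⁺`. -/
theorem thermal_EA_capacity_per_unit_cost_infinite (η nth : ℝ)
    (hη : η ∈ Set.Ioo (0 : ℝ) 1) (hnth : 0 < nth) :
    Filter.Tendsto (fun n : ℝ => F η nth n / n)
      (nhdsWithin 0 (Set.Ioi 0)) Filter.atTop := by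
  obtain ⟨hη0, hη1⟩ := hη
  have hN : 0 < (1 - η) * nth := mul_pos (sub_pos.2 hη1) hnth
  have hD0 := D_zero hN.le
  have hD' := hasDerivAt_D_zero hN.le
  have hDd := hD'.differentiableAt
  set v : ℝ → ℝ := fun n => (D η nth n - (1 - η) * (n - nth) - 1) / 2 with hv
  set u : ℝ → ℝ := fun n => (D η nth n + (1 - η) * (n - nth) - 1) / 2 with hu
  have hv0 : v 0 = (1 - η) * nth := by simp only [hv, hD0]; ring
  have hu0 : u 0 = 0 := by simp only [hu, hD0]; ring
  have hu' : HasDerivAt u (1 - η / ((1 - η) * nth + 1)) 0 := by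
    refine HasDerivAt.congr_deriv (((hD'.add (((hasDerivAt_id (0 : ℝ)).sub_const
      nth).const_mul (1 - η))).sub_const 1).div_const 2) ?_
    ring
  have hvd : DifferentiableAt ℝ v 0 := by fun_prop
  have hquot : η / ((1 - η) * nth + 1) < 1 := by
    rw [div_lt_one (by linarith)]
    linarith
  have hquot0 : 0 < η / ((1 - η) * nth + 1) := by positivity
  have hsing := tendsto_mul_logb_sub_mul_logb_div_atTop (sub_pos.2 hquot)
    (sub_lt_self 1 hquot0) (hu'.tendsto_div_nhdsGT_zero hu0)
  let φ : ℝ → ℝ := fun x => (x + 1) * Real.logb 2 (x + 1)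
  have hφ : DifferentiableAt ℝ φ 0 := differentiableAt_add_one_mul_logb (by norm_num)
  have hφu : DifferentiableAt ℝ (fun n => φ (u n)) 0 :=
    DifferentiableAt.comp (g := φ) 0 (by rwa [hu0]) hu'.differentiableAt
  have hgv : DifferentiableAt ℝ (fun n => g (v n)) 0 :=
    DifferentiableAt.comp (g := g) 0 (differentiableAt_g (by rwa [hv0])) hvd
  have hgl : DifferentiableAt ℝ (fun n => g (η * n + (1 - η) * nth)) 0 :=
    DifferentiableAt.comp (g := g) 0 (differentiableAt_g (by simpa using hN)) (by fun_prop)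
  have hreg := (((hφ.add hgl).sub hgv).sub hφu).hasDerivAt.tendsto_div_nhdsGT_zero
    (by simp [hu0, hv0])
  refine (hsing.atTop_add hreg).congr fun n => ?_
  rw [← add_div]
  congr 1
  change _ = g n + g (η * n + (1 - η) * nth) - g (v n) - g (u n)
  simp only [Pi.add_apply, Pi.sub_apply, φ, g]
  ring
end

section
/- Let h(x) := −x·log₂(x) − (1−x)·log₂(1−x) for x ∈ (0, 1), with h(0) = h(1) = 0, where log₂ denotes the base-2 logarithm. Fix ε, δ ∈ (0, 1). For p ∈ (0, 1] let I(p) := h((1−p)·δ + p·(1−ε)) − (1−p)·h(δ) − p·h(ε). Then sup { I(p)/p : p ∈ (0, 1] } = −(1−ε)·log₂(δ) − ε·log₂(1−δ) − h(ε). -/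
/-- Binary entropy `h x = -x log₂ x - (1-x) log₂ (1-x)`; with Mathlib's
convention `Real.log 0 = 0` this gives `h 0 = h 1 = 0`. -/
noncomputable def h (x : ℝ) : ℝ :=
  -x * Real.logb 2 x - (1 - x) * Real.logb 2 (1 - x)

lemma h_eq_binEntropy_div (x : ℝ) : h x = Real.binEntropy x / Real.log 2 := by
  rw [h, Real.binEntropy_eq_negMulLog_add_negMulLog_one_sub]
  simp only [Real.logb, Real.negMulLog]
  ring

lemma concaveOn_h : ConcaveOn ℝ (Set.Icc 0 1) h := by
  have hlog : (0 : ℝ) ≤ (Real.log 2)⁻¹ := inv_nonneg.2 (Real.log_nonneg one_le_two)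
  refine (Real.strictConcave_binEntropy.concaveOn.smul hlog).congr fun x _ => ?_
  simp only [h_eq_binEntropy_div, div_eq_inv_mul, smul_eq_mul]

lemma hasDerivAt_h {x : ℝ} (hx : x ∈ Set.Ioo (0 : ℝ) 1) :
    HasDerivAt h (Real.logb 2 (1 - x) - Real.logb 2 x) x := by
  rw [funext h_eq_binEntropy_div, Real.logb, Real.logb, ← sub_div]
  exact (Real.hasDerivAt_binEntropy hx.1.ne' hx.2.ne).div_const _

/-- The difference quotients at `0` of a function concave on `[0,1]` have its derivative at `0`
as least upper bound. -/
lemma isLUB_div_of_concaveOn {g : ℝ → ℝ} {d : ℝ} (hg : ConcaveOn ℝ (Set.Icc 0 1) g)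
    (hd : HasDerivAt g d 0) :
    IsLUB ((fun p : ℝ => (g p - g 0) / p) '' Set.Ioc (0 : ℝ) 1) d := by
  constructor
  · rintro _ ⟨p, hp, rfl⟩
    have := hg.slope_le_of_hasDerivAt (Set.left_mem_Icc.2 zero_le_one) ⟨hp.1.le, hp.2⟩ hp.1 hd
    simpa [slope_def_field] using this
  · intro b hb
    refine le_of_tendsto hd.tendsto_slope_zero_right ?_
    filter_upwards [Ioc_mem_nhdsGT zero_lt_one] with p hp
    simpa [div_eq_inv_mul] using hb ⟨p, hp, rfl⟩

/-- The capacity per unit cost of the classical binary channel `B_{ε,δ}`: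
with `I p` the mutual information for input distribution `(1-p, p)`,
`sup { I p / p : p ∈ (0,1] } = -(1-ε) log₂ δ - ε log₂ (1-δ) - h ε`. -/
theorem binary_channel_capacity_per_unit_cost (ε δ : ℝ)
    (hε : ε ∈ Set.Ioo (0 : ℝ) 1) (hδ : δ ∈ Set.Ioo (0 : ℝ) 1) :
    sSup ((fun p : ℝ =>
        (h ((1 - p) * δ + p * (1 - ε)) - (1 - p) * h δ - p * h ε) / p) ''
          Set.Ioc (0 : ℝ) 1)
      = -(1 - ε) * Real.logb 2 δ - ε * Real.logb 2 (1 - δ) - h ε := by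
  have hδ' := Set.Ioo_subset_Icc_self hδ
  have hε' : 1 - ε ∈ Set.Icc (0 : ℝ) 1 := ⟨by linarith [hε.2], by linarith [hε.1]⟩
  let q : ℝ →ᵃ[ℝ] ℝ := AffineMap.lineMap δ (1 - ε)
  have hq (p : ℝ) : q p = (1 - p) * δ + p * (1 - ε) := by
    simp [q, AffineMap.lineMap_apply_module]
  have hconc : ConcaveOn ℝ (Set.Icc 0 1) (h ∘ q) := by
    refine (concaveOn_h.comp_affineMap q).subset (fun p hp => ?_) (convex_Icc 0 1)
    exact (convex_Icc 0 1).lineMap_mem hδ' hε' hp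
  have hderiv : HasDerivAt (h ∘ q)
      ((Real.logb 2 (1 - δ) - Real.logb 2 δ) * ((1 - ε) - δ)) 0 := by
    have hq0 : q 0 = δ := by simp [q]
    exact HasDerivAt.comp 0 (by rw [hq0]; exact hasDerivAt_h hδ) AffineMap.hasDerivAt_lineMap
  have hlin : ConcaveOn ℝ (Set.Icc (0 : ℝ) 1) (fun p => p * (h δ - h ε)) :=
    (LinearMap.mulRight ℝ (h δ - h ε)).concaveOn (convex_Icc 0 1)
  have hlub := isLUB_div_of_concaveOn (hconc.add hlin)
    (hderiv.add ((hasDerivAt_id (0 : ℝ)).mul_const (h δ - h ε)))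
  convert hlub.csSup_eq ((Set.nonempty_Ioc.2 zero_lt_one).image _) using 1
  · congr 2
    funext p
    simp only [Pi.add_apply, Function.comp_apply, hq]
    congr 1
    ring_nf
  · rw [show h δ = -δ * Real.logb 2 δ - (1 - δ) * Real.logb 2 (1 - δ) from rfl]
    ring
end

section
/- Let X be a finite set and let p, q : X → ℝ be probability mass functions (nonnegative, summing to 1) such that for every x ∈ X, q(x) = 0 implies p(x) = 0. For β ∈ (0, 1) define D(β) := Σ_{x : q(x) > 0} (β·p(x) + (1−β)·q(x)) · log₂((β·p(x) + (1−β)·q(x)) / q(x)), the Kullback–Leibler divergence in bits between the mixture β·p + (1−β)·q and q. Then D(β)/β tends to 0 as β tends to 0 from the right. -/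
/-- The derivative at `β = 0` of the summand with masses `a` and `b > 0` in the divergence (in bits)
of the mixture `β a + (1 - β) b` from `b`. -/
theorem hasDerivAt_mixture_mul_logb (a : ℝ) {b : ℝ} (hb : 0 < b) :
    HasDerivAt (fun β : ℝ => (β * a + (1 - β) * b) * Real.logb 2 ((β * a + (1 - β) * b) / b))
      ((a - b) / Real.log 2) 0 := by
  have hmix : HasDerivAt (fun β : ℝ => β * a + (1 - β) * b) (a - b) 0 := by
    exact (((hasDerivAt_id' (0 : ℝ)).mul_const a).add
      (((hasDerivAt_id' (0 : ℝ)).const_sub 1).mul_const b)).congr_deriv (by ring)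
  have hlog := ((hmix.div_const b).log (by simp [hb.ne'])).div_const (Real.log 2)
  refine (hmix.mul hlog).congr_deriv ?_
  simp only [zero_mul, sub_zero, one_mul, zero_add, div_self hb.ne', Real.log_one, zero_div,
    mul_zero, div_one]
  field_simp

/-- For probability mass functions `p, q` on a finite set with `p` absolutely
continuous with respect to `q`, the KL divergence (in bits) between the
mixture `β p + (1-β) q` and `q` vanishes faster than linearly:
`D(β p + (1-β) q ‖ q) / β → 0` as `β → 0⁺`. -/
theorem kl_mixture_ratio_tendsto_zero {X : Type*} [Fintype X] (p q : X → ℝ)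
    (hp0 : ∀ x, 0 ≤ p x) (hp1 : ∑ x, p x = 1)
    (hq0 : ∀ x, 0 ≤ q x) (hq1 : ∑ x, q x = 1)
    (hac : ∀ x, q x = 0 → p x = 0) :
    Filter.Tendsto
      (fun β : ℝ =>
        (∑ x ∈ Finset.univ.filter (fun x => 0 < q x),
          (β * p x + (1 - β) * q x) *
            Real.logb 2 ((β * p x + (1 - β) * q x) / q x)) / β)
      (nhdsWithin 0 (Set.Ioi 0)) (nhds 0) := by
  have hsum : ∑ x ∈ Finset.univ.filter (fun x => 0 < q x), (p x - q x) / Real.log 2 = 0 := by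
    rw [Finset.sum_filter_of_ne, ← Finset.sum_div, Finset.sum_sub_distrib, hp1, hq1, sub_self,
      zero_div]
    intro x _ hx
    refine (hq0 x).lt_of_ne fun h => hx ?_
    simp [hac x h.symm, ← h]
  have hderiv := HasDerivAt.fun_sum (u := Finset.univ.filter (fun x => 0 < q x))
    fun x hx => hasDerivAt_mixture_mul_logb (p x) (Finset.mem_filter.1 hx).2
  rw [hsum] at hderiv
  refine hderiv.tendsto_slope_zero_right.congr fun β => ?_
  have hzero : ∑ x ∈ Finset.univ.filter (fun x => 0 < q x),
      (0 * p x + (1 - 0) * q x) * Real.logb 2 ((0 * p x + (1 - 0) * q x) / q x) = 0 :=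
    Finset.sum_eq_zero fun x hx => by simp [(Finset.mem_filter.1 hx).2.ne']
  rw [hzero, zero_add, sub_zero, smul_eq_mul, div_eq_inv_mul]
end
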